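/- Let n ≥ 1 and q ≥ 2 be integers, let t_0, …, t_n be nonzero complex numbers, and set W = Σ_{j=0}^n t_j A_j. Then W satisfies the type II condition — for all vertices a and b, Σ_c W_{a,c}/W_{b,c} equals q^n if a = b and equals 0 otherwise — if and only if for every s with 0 ≤ s ≤ n, (Σ_{h=0}^n p_h(s) t_h)·(Σ_{j=0}^n p_j(s) t_j^{−1}) = q^n. -/

import Mathlib

open Matrix

/-- The distance-`j` matrix of the Hamming scheme `H(n,q)`. -/
noncomputable def hammingA (n q j : ℕ) :
    Matrix (Fin n → Fin q) (Fin n → Fin q) ℂ :=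
  Matrix.of fun a b => if hammingDist a b = j then 1 else 0

/-- The eigenvalues of the Hamming scheme:
`p_r(s) = ∑_{h=0}^{r} (−q)^h (q−1)^{r−h} C(n−h, r−h) C(s, h)`. -/
noncomputable def hammingP (n q r s : ℕ) : ℂ :=
  ∑ h ∈ Finset.range (r + 1),
    (-(q : ℂ)) ^ h * ((q : ℂ) - 1) ^ (r - h) *
      (Nat.choose (n - h) (r - h) : ℂ) * (Nat.choose s h : ℂ)

open Polynomial in
theorem hammingP_eq_coeff (n q r s : ℕ) (hs : s ≤ n) :
    hammingP n q r s =
      ((1 + C ((q : ℂ) - 1) * X) ^ (n - s) * (1 - X) ^ s : ℂ[X]).coeff r := by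
  have hlin : (1 - X : ℂ[X]) = C (-(q : ℂ)) * X + (1 + C ((q : ℂ) - 1) * X) := by
    simp only [map_neg, map_sub, map_one]
    ring
  have hexp : ((1 + C ((q : ℂ) - 1) * X) ^ (n - s) * (1 - X) ^ s : ℂ[X]) =
      ∑ h ∈ Finset.range (s + 1), C ((-(q : ℂ)) ^ h * (s.choose h : ℂ)) *
        ((1 + C ((q : ℂ) - 1) * X) ^ (n - h) * X ^ h) := by
    rw [hlin, add_pow (C (-(q : ℂ)) * X), Finset.mul_sum]
    refine Finset.sum_congr rfl fun h hh => ?_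
    have hh' : h ≤ s := Nat.lt_succ_iff.mp (Finset.mem_range.mp hh)
    rw [show n - h = (n - s) + (s - h) by omega, pow_add, mul_pow, C_mul, C_pow, C_eq_natCast]
    ring
  have hcoeff (m k : ℕ) : ((1 + C ((q : ℂ) - 1) * X) ^ m : ℂ[X]).coeff k =
      ((q : ℂ) - 1) ^ k * (m.choose k : ℂ) := by
    have hcomp : ((1 + C ((q : ℂ) - 1) * X) ^ m : ℂ[X]) =
        ((1 + X) ^ m : ℂ[X]).comp (C ((q : ℂ) - 1) * X) := by simp
    rw [hcomp, comp_C_mul_X_coeff, coeff_one_add_X_pow, mul_comm]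
  rw [hexp, finsetSum_coeff, hammingP]
  simp only [coeff_C_mul, coeff_mul_X_pow', hcoeff]
  have hext (N : ℕ) (hN : N ≤ r + s) (g : ℕ → ℂ) (hg : ∀ h, N < h → g h = 0) :
      ∑ h ∈ Finset.range (N + 1), g h = ∑ h ∈ Finset.range (r + s + 1), g h := by
    refine Finset.sum_subset (Finset.range_mono (by omega)) fun h _ hh => hg h ?_
    simpa using hh
  rw [hext s (by omega) _ fun h hh => by simp [Nat.choose_eq_zero_of_lt hh]]
  rw [← hext r (by omega) _ fun h hh => by simp [Nat.not_le.mpr hh]]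
  refine Finset.sum_congr rfl fun h hh => ?_
  rw [if_pos (Nat.lt_succ_iff.mp (Finset.mem_range.mp hh))]
  ring

theorem sum_fin_pow_eq_zero {q : ℕ} {z : ℂ} (hz : z ^ q = 1) (hz1 : z ≠ 1) :
    ∑ u : Fin q, z ^ (u : ℕ) = 0 := by
  rw [Fin.sum_univ_eq_sum_range (fun k => z ^ k), geom_sum_eq hz1, hz]
  simp

/-- The character table of `(ℤ/q)ⁿ` attached to a `q`-th root of unity `ζ`. -/
noncomputable def hammingChar (n q : ℕ) (ζ : ℂ) (a u : Fin n → Fin q) : ℂ :=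
  ∏ i, ζ ^ ((a i : ℕ) * (u i : ℕ))

/-- The number of coordinates of `u` with nonzero value. -/
def hammingWeight {n q : ℕ} (u : Fin n → Fin q) : ℕ :=
  (Finset.univ.filter fun i => ¬ (u i : ℕ) = 0).card

theorem hammingWeight_le {n q : ℕ} (u : Fin n → Fin q) : hammingWeight u ≤ n :=
  (Finset.card_le_univ _).trans_eq (Fintype.card_fin n)

theorem exists_hammingWeight_eq {n q s : ℕ} (hq : 2 ≤ q) (hs : s ≤ n) :
    ∃ u : Fin n → Fin q, hammingWeight u = s := by
  obtain ⟨S, -, hS⟩ := Finset.exists_subset_card_eq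
    (s := (Finset.univ : Finset (Fin n))) (n := s) (by simpa using hs)
  refine ⟨fun i => if i ∈ S then ⟨1, by omega⟩ else ⟨0, by omega⟩, ?_⟩
  rw [hammingWeight, ← hS]
  congr 1
  ext i
  by_cases hi : i ∈ S <;> simp [hi]

theorem hammingChar_ne_zero {n q : ℕ} {ζ : ℂ} (hζ : ζ ≠ 0) (a u : Fin n → Fin q) :
    hammingChar n q ζ a u ≠ 0 :=
  Finset.prod_ne_zero_iff.mpr fun _ _ => pow_ne_zero _ hζ

theorem sum_hammingChar_mul_inv {n q : ℕ} {ζ : ℂ} (hζ : IsPrimitiveRoot ζ q)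
    (hq : q ≠ 0) (a b : Fin n → Fin q) :
    ∑ u, hammingChar n q ζ a u * (hammingChar n q ζ b u)⁻¹ =
      if a = b then (q : ℂ) ^ n else 0 := by
  have h0 : ζ ≠ 0 := hζ.ne_zero hq
  have hfac : ∑ u, hammingChar n q ζ a u * (hammingChar n q ζ b u)⁻¹ =
      ∏ i, ∑ v : Fin q, (ζ ^ (a i : ℕ) / ζ ^ (b i : ℕ)) ^ (v : ℕ) := by
    rw [Finset.prod_univ_sum, Fintype.piFinset_univ]
    refine Finset.sum_congr rfl fun u _ => ?_
    rw [hammingChar, hammingChar, ← Finset.prod_inv_distrib, ← Finset.prod_mul_distrib]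
    refine Finset.prod_congr rfl fun i _ => ?_
    rw [div_pow, ← pow_mul, ← pow_mul, div_eq_mul_inv]
  rw [hfac]
  split_ifs with hab
  · subst hab
    simp [h0]
  · obtain ⟨i, hi⟩ := Function.ne_iff.mp hab
    refine Finset.prod_eq_zero (Finset.mem_univ i) (sum_fin_pow_eq_zero ?_ fun h => hi ?_)
    · rw [div_pow, ← pow_mul, ← pow_mul, mul_comm, pow_mul, mul_comm (b i : ℕ), pow_mul,
        hζ.pow_eq_one]
      simp
    · rw [div_eq_one_iff_eq (pow_ne_zero _ h0)] at h
      exact Fin.ext (hζ.pow_inj (a i).2 (b i).2 h)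

open Polynomial in
theorem sum_C_mul_X_pow_ne {q : ℕ} {ζ : ℂ} (hζ : IsPrimitiveRoot ζ q) (a v : Fin q) :
    ∑ c : Fin q, C (ζ ^ ((c : ℕ) * (v : ℕ))) * (if a ≠ c then X else 1 : ℂ[X]) =
      C (ζ ^ ((a : ℕ) * (v : ℕ))) *
        (if (v : ℕ) = 0 then 1 + C ((q : ℂ) - 1) * X else 1 - X) := by
  have hsum : ∑ c : Fin q, C (ζ ^ ((c : ℕ) * (v : ℕ))) * (if a ≠ c then X else 1 : ℂ[X]) =
      C (∑ c : Fin q, (ζ ^ (v : ℕ)) ^ (c : ℕ)) * X +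
        C (ζ ^ ((a : ℕ) * (v : ℕ))) * (1 - X) := by
    have hterm (c : Fin q) : C (ζ ^ ((c : ℕ) * (v : ℕ))) * (if a ≠ c then X else 1 : ℂ[X]) =
        C ((ζ ^ (v : ℕ)) ^ (c : ℕ)) * X +
          (if a = c then C (ζ ^ ((c : ℕ) * (v : ℕ))) * (1 - X) else 0) := by
      rw [← pow_mul, mul_comm (v : ℕ)]
      split_ifs <;> first | contradiction | ring
    simp only [hterm, Finset.sum_add_distrib, Finset.sum_ite_eq, Finset.mem_univ, if_true,
      ← Finset.sum_mul, map_sum]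
  rw [hsum]
  split_ifs with hv
  · simp [hv]
    ring
  · rw [sum_fin_pow_eq_zero]
    · simp
    · rw [← pow_mul, mul_comm, pow_mul, hζ.pow_eq_one, one_pow]
    · exact hζ.pow_ne_one_of_pos_of_lt hv v.2

open Polynomial in
theorem sum_C_hammingChar_mul_X_pow {n q : ℕ} {ζ : ℂ} (hζ : IsPrimitiveRoot ζ q)
    (a u : Fin n → Fin q) :
    ∑ c, C (hammingChar n q ζ c u) * (X : ℂ[X]) ^ hammingDist a c =
      C (hammingChar n q ζ a u) *
        ((1 + C ((q : ℂ) - 1) * X) ^ (n - hammingWeight u) * (1 - X) ^ hammingWeight u) := by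
  have hfac : ∑ c, C (hammingChar n q ζ c u) * (X : ℂ[X]) ^ hammingDist a c =
      ∏ i, ∑ c : Fin q,
        C (ζ ^ ((c : ℕ) * (u i : ℕ))) * (if a i ≠ c then X else 1 : ℂ[X]) := by
    rw [Finset.prod_univ_sum, Fintype.piFinset_univ]
    refine Finset.sum_congr rfl fun c _ => ?_
    rw [hammingChar, map_prod, Finset.prod_mul_distrib]
    congr 1
    rw [Finset.prod_ite, Finset.prod_const, Finset.prod_const_one, mul_one]
    rfl
  have hcard : (Finset.univ.filter fun i => (u i : ℕ) = 0).card = n - hammingWeight u := by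
    have := Finset.card_filter_add_card_filter_not
      (s := (Finset.univ : Finset (Fin n))) (fun i => (u i : ℕ) = 0)
    rw [Finset.card_univ, Fintype.card_fin] at this
    rw [hammingWeight]
    omega
  rw [hfac, Finset.prod_congr rfl fun i _ => sum_C_mul_X_pow_ne hζ (a i) (u i),
    Finset.prod_mul_distrib, Finset.prod_ite, Finset.prod_const, Finset.prod_const, hcard,
    hammingChar, map_prod]
  rfl

/-- The characters are eigenvectors of every matrix of the Hamming scheme. -/
theorem sum_apply_hammingDist_mul_hammingChar {n q : ℕ} {ζ : ℂ} (hζ : IsPrimitiveRoot ζ q)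
    (t : ℕ → ℂ) (a u : Fin n → Fin q) :
    ∑ c, t (hammingDist a c) * hammingChar n q ζ c u =
      hammingChar n q ζ a u *
        ∑ h ∈ Finset.range (n + 1), hammingP n q h (hammingWeight u) * t h := by
  have hcoeff (j : ℕ) : ∑ c, (if hammingDist a c = j then hammingChar n q ζ c u else 0) =
      hammingChar n q ζ a u * hammingP n q j (hammingWeight u) := by
    rw [hammingP_eq_coeff _ _ _ _ (hammingWeight_le u), ← Polynomial.coeff_C_mul,
      ← sum_C_hammingChar_mul_X_pow hζ, Polynomial.finsetSum_coeff]
    refine Finset.sum_congr rfl fun c _ => ?_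
    rw [Polynomial.coeff_C_mul_X_pow]
    simp only [eq_comm]
  simp only [Finset.mul_sum, ← mul_assoc, ← hcoeff, Finset.sum_mul]
  rw [Finset.sum_comm]
  refine Finset.sum_congr rfl fun c _ => ?_
  have hd : hammingDist a c < n + 1 :=
    Nat.lt_succ_of_le (hammingDist_le_card_fintype.trans_eq (Fintype.card_fin n))
  simp [hd, mul_comm]

theorem sum_smul_hammingA_apply {n q : ℕ} (t : ℕ → ℂ) (a b : Fin n → Fin q) :
    (∑ j ∈ Finset.range (n + 1), t j • hammingA n q j) a b = t (hammingDist a b) := by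
  have hd : hammingDist a b < n + 1 :=
    Nat.lt_succ_of_le (hammingDist_le_card_fintype.trans_eq (Fintype.card_fin n))
  simp [Matrix.sum_apply, hammingA, hd]

theorem hamming_typeII_iff (n q : ℕ) (hn : 1 ≤ n) (hq : 2 ≤ q)
    (t : ℕ → ℂ) (ht : ∀ j ≤ n, t j ≠ 0) :
    (∀ a b : Fin n → Fin q,
        (∑ c : Fin n → Fin q,
            (∑ j ∈ Finset.range (n + 1), t j • hammingA n q j) a c /
              (∑ j ∈ Finset.range (n + 1), t j • hammingA n q j) b c) =
          if a = b then ((q : ℂ) ^ n) else 0) ↔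
      ∀ s ≤ n,
        (∑ h ∈ Finset.range (n + 1), hammingP n q h s * t h) *
            (∑ j ∈ Finset.range (n + 1), hammingP n q j s * (t j)⁻¹) =
          (q : ℂ) ^ n := by
  have hq0 : q ≠ 0 := by omega
  obtain ⟨ζ, hζ⟩ : ∃ ζ : ℂ, IsPrimitiveRoot ζ q := ⟨_, Complex.isPrimitiveRoot_exp q hq0⟩
  have hqn : (q : ℂ) ^ n ≠ 0 := pow_ne_zero _ (Nat.cast_ne_zero.mpr hq0)
  simp only [sum_smul_hammingA_apply, div_eq_mul_inv]
  set F := hammingChar n q ζ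
  set μ : ℕ → ℂ := fun s =>
    (∑ h ∈ Finset.range (n + 1), hammingP n q h s * t h) *
      (∑ j ∈ Finset.range (n + 1), hammingP n q j s * (t j)⁻¹) with hμ
  set M : Matrix (Fin n → Fin q) (Fin n → Fin q) ℂ := Matrix.of fun a b =>
    ∑ c, t (hammingDist a c) * (t (hammingDist b c))⁻¹ with hM
  have hMF (a u : Fin n → Fin q) : ∑ b, M a b * F b u = F a u * μ (hammingWeight u) := by
    simp only [hM, Matrix.of_apply, Finset.sum_mul, mul_assoc]
    rw [Finset.sum_comm]
    simp only [← Finset.mul_sum]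
    have hinv (c : Fin n → Fin q) :=
      sum_apply_hammingDist_mul_hammingChar hζ (fun j => (t j)⁻¹) c u
    have hrow (c : Fin n → Fin q) : ∑ b, (t (hammingDist b c))⁻¹ * F b u =
        F c u * ∑ j ∈ Finset.range (n + 1), hammingP n q j (hammingWeight u) * (t j)⁻¹ := by
      rw [← hinv c]
      exact Finset.sum_congr rfl fun b _ => by rw [hammingDist_comm]
    simp only [hrow, ← mul_assoc, ← Finset.sum_mul]
    rw [sum_apply_hammingDist_mul_hammingChar hζ t a u]
    simp only [hμ, mul_assoc]
    rfl
  constructor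
  · intro h s hs
    obtain ⟨u, rfl⟩ := exists_hammingWeight_eq hq hs
    let a : Fin n → Fin q := fun _ => ⟨0, by omega⟩
    refine mul_left_cancel₀ (hammingChar_ne_zero (hζ.ne_zero hq0) a u) ((hMF a u).symm.trans ?_)
    simp only [hM, Matrix.of_apply, h, ite_mul, zero_mul, Finset.sum_ite_eq, Finset.mem_univ,
      if_true]
    exact mul_comm _ _
  · intro h a b
    have hμq (u : Fin n → Fin q) : μ (hammingWeight u) = (q : ℂ) ^ n :=
      h _ (hammingWeight_le u)
    have hmul : M a b * (q : ℂ) ^ n = (if a = b then (q : ℂ) ^ n else 0) * (q : ℂ) ^ n := by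
      rw [← sum_hammingChar_mul_inv hζ hq0 a b, Finset.sum_mul]
      calc M a b * (q : ℂ) ^ n
          = ∑ c, M a c * (if c = b then (q : ℂ) ^ n else 0) := by simp
        _ = ∑ c, ∑ u, M a c * F c u * (F b u)⁻¹ := by
          simp only [← sum_hammingChar_mul_inv hζ hq0, Finset.mul_sum, mul_assoc]
          rfl
        _ = ∑ u, F a u * (F b u)⁻¹ * (q : ℂ) ^ n := by
          rw [Finset.sum_comm]
          refine Finset.sum_congr rfl fun u _ => ?_
          rw [← Finset.sum_mul, hMF, hμq]
          ring
    exact mul_right_cancel₀ hqn hmul
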